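/- Let h > 0, N ∈ ℕ, t_i = i·h for i = 0, …, N, and let L, V, μ > 0 with Δ = ⌈L/(V·h)⌉ ≤ N. Let q₀ ≥ 0 and let (Q_i)_{i=0}^N be a nondecreasing sequence of nonnegative reals. Define Q̂₀ = 0 and Q̂_i = q₀ + Q_i for 1 ≤ i ≤ N, and for Δ ≤ i ≤ N define U_i = min_{0 ≤ j ≤ i − Δ} ( Q̂_j − μ·t_j ) + (t_i − L/V)·μ. Then 0 ≤ U_i for all Δ ≤ i ≤ N, and U_i ≤ U_{i+1} for all Δ ≤ i ≤ N − 1. -/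

import Mathlib

/-- The discrete Lax formula `U_i = min_{0 ≤ j ≤ i-Δ} (Q̂_j - μ t_j) + (t_i - L/V) μ`,
with `Δ = ⌈L/(Vh)⌉`, `Q̂₀ = 0`, `Q̂_i = q₀ + Q_i`, satisfies `0 ≤ U_i ≤ U_{i+1}`. -/
theorem discrete_lax_nonneg_monotone (h : ℝ) (hh : 0 < h) (N : ℕ) (L V μ : ℝ)
    (hL : 0 < L) (hV : 0 < V) (hμ : 0 < μ) (hΔN : ⌈L / (V * h)⌉₊ ≤ N)
    (q0 : ℝ) (hq0 : 0 ≤ q0) (Q : ℕ → ℝ)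
    (hQmono : ∀ i j : ℕ, i ≤ j → j ≤ N → Q i ≤ Q j) (hQnonneg : ∀ i ≤ N, 0 ≤ Q i) :
    let Δ : ℕ := ⌈L / (V * h)⌉₊
    let Qhat : ℕ → ℝ := fun i => if i = 0 then 0 else q0 + Q i
    let U : ℕ → ℝ := fun i =>
      (Finset.range (i - Δ + 1)).inf' (Finset.nonempty_range_iff.mpr (by omega))
          (fun j => Qhat j - μ * (j * h)) +
        ((i : ℝ) * h - L / V) * μ
    (∀ i : ℕ, Δ ≤ i → i ≤ N → 0 ≤ U i) ∧
    (∀ i : ℕ, Δ ≤ i → i + 1 ≤ N → U i ≤ U (i + 1)) := by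
  intro Δ Qhat U
  have hΔ : L / V ≤ Δ * h := by
    have hceil : L / (V * h) ≤ Δ := Nat.le_ceil _
    rwa [← div_div, div_le_iff₀ hh] at hceil
  have hQhat_nonneg : ∀ j ≤ N, 0 ≤ Qhat j := by
    intro j hj
    simp only [Qhat]
    split_ifs
    · exact le_rfl
    · exact add_nonneg hq0 (hQnonneg j hj)
  have hQhat_succ : ∀ j, j + 1 ≤ N → Qhat j ≤ Qhat (j + 1) := by
    intro j hj
    by_cases hj0 : j = 0
    · simpa [Qhat, hj0] using hQhat_nonneg (j + 1) hj
    · simpa [Qhat, hj0] using hQmono j (j + 1) j.le_succ hj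
  have hU_le : ∀ i j, j ≤ i - Δ →
      U i ≤ Qhat j - μ * (j * h) + ((i : ℝ) * h - L / V) * μ := fun i j hj =>
    add_le_add_left (Finset.inf'_le (fun j : ℕ => Qhat j - μ * (j * h))
      (Finset.mem_range.mpr (Nat.lt_succ_of_le hj))) _
  have hle_U : ∀ (i : ℕ) (a : ℝ),
      (∀ j ≤ i - Δ, a ≤ Qhat j - μ * (j * h) + ((i : ℝ) * h - L / V) * μ) → a ≤ U i := by
    intro i a ha
    refine sub_le_iff_le_add.mp (Finset.le_inf' _ _ fun j hj => ?_)
    exact sub_le_iff_le_add.mpr (ha j (Nat.le_of_lt_succ (Finset.mem_range.mp hj)))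
  have hμh : 0 < μ * h := mul_pos hμ hh
  refine ⟨fun i hi hiN => hle_U i 0 fun j hj => ?_, fun i hi hiN => hle_U (i + 1) _ fun j hj => ?_⟩
  · have hji : (j : ℝ) + Δ ≤ i := by exact_mod_cast (show j + Δ ≤ i by omega)
    have htime : 0 ≤ ((i : ℝ) * h - L / V - j * h) * μ :=
      mul_nonneg (by linarith [mul_le_mul_of_nonneg_right hji hh.le]) hμ.le
    linarith [hQhat_nonneg j (by omega)]
  · push_cast
    rcases Nat.lt_or_ge (i - Δ) j with hlt | hle
    · obtain rfl : j = i - Δ + 1 := by omega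
      have hU := hU_le i (i - Δ) le_rfl
      have hQ := hQhat_succ (i - Δ) (by omega)
      push_cast
      linarith
    · linarith [hU_le i j hle]
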